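/- Assume all the functions g_t, t ∈ T, are convex and uniformly Fréchet differentiable at x̄ ∈ Ω and that h = A is a surjective continuous linear operator, and suppose the PMFCQ (equivalently, the SSC) holds at x̄. Then the normal cone to the convex set Ω at x̄ in the sense of convex analysis is N(x̄; Ω) = ⋂_{ε>0} cl* cone{∇g_t(x̄) : t ∈ T_ε(x̄)} + A*(Y*). If in addition the NFMCQ holds at x̄, then N(x̄; Ω) = cone{∇g_t(x̄) : t ∈ T(x̄)} + A*(Y*). -/

import Mathlib

open Filter Topology Set Pointwise

section Defs

variable {X : Type*} [NormedAddCommGroup X] [NormedSpace ℝ X]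

/-- The canonical identification of the dual of `X` with its weak* dual. -/
def toWD (p : X →L[ℝ] ℝ) : WeakDual ℝ X := p

/-- The weak* closure of a subset of the dual. -/
def wkClosure (S : Set (X →L[ℝ] ℝ)) : Set (X →L[ℝ] ℝ) :=
  {p | toWD p ∈ closure (toWD '' S)}

/-- A subset of the dual is weak* closed. -/
def IsWeakStarClosed (S : Set (X →L[ℝ] ℝ)) : Prop :=
  IsClosed (toWD '' S)

/-- A subset of `X* × ℝ` is weak* closed. -/
def IsWeakStarClosedProd (S : Set ((X →L[ℝ] ℝ) × ℝ)) : Prop :=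
  IsClosed ((fun p : (X →L[ℝ] ℝ) × ℝ => (toWD p.1, p.2)) '' S)

/-- The convex conic hull of `S ∪ {0}`: all finite nonnegative combinations of elements of `S`. -/
def coneHull {E : Type*} [AddCommMonoid E] [Module ℝ E] (S : Set E) : Set E :=
  {x | ∃ (n : ℕ) (c : Fin n → ℝ) (v : Fin n → E),
    (∀ i, 0 ≤ c i) ∧ (∀ i, v i ∈ S) ∧ x = ∑ i, c i • v i}

/-- The set of ε-normals to `Ω` at `x`. -/
def epsNormal (Ω : Set X) (x : X) (ε : ℝ) : Set (X →L[ℝ] ℝ) :=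
  {p | ∀ γ > (0:ℝ), ∃ δ > (0:ℝ), ∀ u ∈ Ω, ‖u - x‖ < δ → p (u - x) ≤ (ε + γ) * ‖u - x‖}

/-- The Fréchet (regular) normal cone to `Ω` at `x`. -/
def frechetNormal (Ω : Set X) (x : X) : Set (X →L[ℝ] ℝ) := epsNormal Ω x 0

/-- The limiting (Mordukhovich) normal cone to `Ω` at `xb`. -/
def limitingNormal (Ω : Set X) (xb : X) : Set (X →L[ℝ] ℝ) :=
  {p | ∃ (ε : ℕ → ℝ) (xs : ℕ → X) (ps : ℕ → X →L[ℝ] ℝ),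
    (∀ n, 0 ≤ ε n) ∧ Tendsto ε atTop (𝓝 0) ∧
    (∀ n, xs n ∈ Ω) ∧ Tendsto xs atTop (𝓝 xb) ∧
    (∀ n, ps n ∈ epsNormal Ω (xs n) (ε n)) ∧
    (∀ v : X, Tendsto (fun n => ps n v) atTop (𝓝 (p v)))}

/-- The normal cone of convex analysis to `Ω` at `xb`. -/
def convexNormal (Ω : Set X) (xb : X) : Set (X →L[ℝ] ℝ) :=
  {p | ∀ x ∈ Ω, p (x - xb) ≤ 0}

/-- The subdifferential of convex analysis of `f` at `xb`. -/
def convexSubdiff (f : X → ℝ) (xb : X) : Set (X →L[ℝ] ℝ) :=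
  {p | ∀ x, f xb + p (x - xb) ≤ f x}

variable {Y : Type*} [NormedAddCommGroup Y] [NormedSpace ℝ Y]

/-- The image `A*(Y*)` of the adjoint operator `A* : Y* → X*`. -/
def adjRange (A : X →L[ℝ] Y) : Set (X →L[ℝ] ℝ) :=
  Set.range fun q : Y →L[ℝ] ℝ => q.comp A

variable {T : Type*}

/-- Uniform Fréchet differentiability of the family `g = (g t)` at `xb`:
`s(η) := sup_t sup_{x ∈ B_η(xb), x ≠ xb} |g t x - g t xb - ⟨dg t, x - xb⟩|/‖x - xb‖ → 0` as `η ↓ 0`. -/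
def UnifFrechetDiffAt (g : T → X → ℝ) (dg : T → X →L[ℝ] ℝ) (xb : X) : Prop :=
  ∀ ε > (0:ℝ), ∃ η > (0:ℝ), ∀ t : T, ∀ x : X, ‖x - xb‖ ≤ η →
    |g t x - g t xb - dg t (x - xb)| ≤ ε * ‖x - xb‖

/-- Uniform strict differentiability of the family `g = (g t)` at `xb`:
`r(η) := sup_t sup_{x,x' ∈ B_η(xb), x ≠ x'} |g t x - g t x' - ⟨dg t, x - x'⟩|/‖x - x'‖ → 0`
as `η ↓ 0`. -/
def UnifStrictDiffAt (g : T → X → ℝ) (dg : T → X →L[ℝ] ℝ) (xb : X) : Prop :=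
  ∀ ε > (0:ℝ), ∃ η > (0:ℝ), ∀ t : T, ∀ x x' : X, ‖x - xb‖ ≤ η → ‖x' - xb‖ ≤ η →
    |g t x - g t x' - dg t (x - x')| ≤ ε * ‖x - x'‖

/-- The inequality part of the PMFCQ at `xb` with the direction `xt`:
`inf_{ε>0} sup_{t ∈ T_ε(xb)} ⟨dg t, xt⟩ < 0`, where `T_ε(xb) = {t | g t xb ≥ -ε}`. -/
def PMFCQat (g : T → X → ℝ) (dg : T → X →L[ℝ] ℝ) (xb xt : X) : Prop :=
  ∃ ε > (0:ℝ), ∃ δ > (0:ℝ), ∀ t : T, -ε ≤ g t xb → dg t xt ≤ -δ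

end Defs

section Helpers

lemma coneHull_zero {E : Type*} [AddCommMonoid E] [Module ℝ E] (S : Set E) :
    (0 : E) ∈ coneHull S :=
  ⟨0, Fin.elim0, Fin.elim0, fun i => i.elim0, fun i => i.elim0, by simp⟩

lemma coneHull_gen {E : Type*} [AddCommMonoid E] [Module ℝ E] {S : Set E} {x : E} (hx : x ∈ S) :
    x ∈ coneHull S :=
  ⟨1, fun _ => 1, fun _ => x, fun _ => zero_le_one, fun _ => hx, by simp⟩

lemma coneHull_add {E : Type*} [AddCommMonoid E] [Module ℝ E] {S : Set E} {x y : E}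
    (hx : x ∈ coneHull S) (hy : y ∈ coneHull S) : x + y ∈ coneHull S := by
  obtain ⟨n, c, v, hc, hv, rfl⟩ := hx
  obtain ⟨m, d, w, hd, hw, rfl⟩ := hy
  refine ⟨n + m, Fin.append c d, Fin.append v w, ?_, ?_, ?_⟩
  · intro i
    refine Fin.addCases (fun j => ?_) (fun j => ?_) i
    · simpa using hc j
    · simpa using hd j
  · intro i
    refine Fin.addCases (fun j => ?_) (fun j => ?_) i
    · simpa using hv j
    · simpa using hw j
  · simp [Fin.sum_univ_add]

lemma coneHull_smul {E : Type*} [AddCommMonoid E] [Module ℝ E] {S : Set E} {x : E} {r : ℝ}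
    (hr : 0 ≤ r) (hx : x ∈ coneHull S) : r • x ∈ coneHull S := by
  obtain ⟨n, c, v, hc, hv, rfl⟩ := hx
  exact ⟨n, fun i => r * c i, v, fun i => mul_nonneg hr (hc i), hv, by
    simp [Finset.smul_sum, smul_smul]⟩

lemma coneHull_ind {E : Type*} [AddCommMonoid E] [Module ℝ E] {S : Set E} {P : E → Prop}
    (h0 : P 0) (hadd : ∀ x y, P x → P y → P (x + y))
    (hsmul : ∀ (r : ℝ) x, 0 ≤ r → P x → P (r • x)) (hS : ∀ x ∈ S, P x)
    {x : E} (hx : x ∈ coneHull S) : P x := by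
  obtain ⟨n, c, v, hc, hv, rfl⟩ := hx
  exact Finset.sum_induction _ P hadd h0 fun i _ => hsmul _ _ (hc i) (hS _ (hv i))

lemma coneHull_mono {E : Type*} [AddCommMonoid E] [Module ℝ E] {S S' : Set E} (h : S ⊆ S') :
    coneHull S ⊆ coneHull S' := by
  rintro x ⟨n, c, v, hc, hv, rfl⟩
  exact ⟨n, c, v, hc, fun i => h (hv i), rfl⟩

variable {X : Type*} [NormedAddCommGroup X] [NormedSpace ℝ X]
variable {Y : Type*} [NormedAddCommGroup Y] [NormedSpace ℝ Y]
variable {T : Type*}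

/-- the annihilator of the kernel of `A`, as a set in the weak* dual -/
def annKer (A : X →L[ℝ] Y) : Set (WeakDual ℝ X) := {q | ∀ v, A v = 0 → q v = 0}

lemma annKer_closed (A : X →L[ℝ] Y) : IsClosed (annKer A) := by
  have : annKer A = ⋂ v, ⋂ (_ : A v = 0), {q : WeakDual ℝ X | q v = 0} := by
    ext q; simp [annKer]
  rw [this]
  exact isClosed_iInter fun v => isClosed_iInter fun _ =>
    isClosed_eq (WeakDual.eval_continuous v) continuous_const

lemma mem_adjRange_of_annKer [CompleteSpace X] [CompleteSpace Y] (A : X →L[ℝ] Y)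
    (hsurj : Function.Surjective A) (q : X →L[ℝ] ℝ) (hq : ∀ v, A v = 0 → q v = 0) :
    q ∈ adjRange A := by
  obtain ⟨s, hs⟩ := (A : X →ₗ[ℝ] Y).exists_rightInverse_of_surjective
    (LinearMap.range_eq_top.2 hsurj)
  have hs' : ∀ y, A (s y) = y := fun y => LinearMap.congr_fun hs y
  have key : ∀ x, q (s (A x)) = q x := by
    intro x
    have := hq (s (A x) - x) (by simp [hs'])
    rw [map_sub] at this
    linarith
  have hcont : Continuous ((q : X →ₗ[ℝ] ℝ) ∘ₗ s) := by
    have hQ : IsQuotientMap A := (A.isOpenMap hsurj).isQuotientMap A.continuous hsurj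
    rw [hQ.continuous_iff]
    have : (⇑((q : X →ₗ[ℝ] ℝ) ∘ₗ s) ∘ A) = q := by
      ext x; simpa using key x
    rw [this]
    exact q.continuous
  refine ⟨⟨(q : X →ₗ[ℝ] ℝ) ∘ₗ s, hcont⟩, ?_⟩
  ext x
  exact key x

/-- Bipolar theorem for convex cones in the weak* dual. -/
lemma mem_closure_cone (C : Set (WeakDual ℝ X)) (h0 : (0 : WeakDual ℝ X) ∈ C)
    (hadd : ∀ x ∈ C, ∀ y ∈ C, x + y ∈ C)
    (hsmul : ∀ (r : ℝ), 0 ≤ r → ∀ x ∈ C, r • x ∈ C) (p : WeakDual ℝ X)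
    (hp : ∀ v : X, (∀ q ∈ C, q v ≤ 0) → p v ≤ 0) : p ∈ closure C := by
  by_contra hcon
  have hconv : Convex ℝ C := fun x hx y hy a b ha hb _ =>
    hadd _ (hsmul a ha x hx) _ (hsmul b hb y hy)
  have : LocallyConvexSpace ℝ (WeakDual ℝ X) :=
    WeakBilin.locallyConvexSpace (B := topDualPairing ℝ X)
  obtain ⟨f, u, hfu, hup⟩ := geometric_hahn_banach_closed_point hconv.closure isClosed_closure hcon
  obtain ⟨v, hv⟩ := LinearMap.dualEmbedding_surjective (topDualPairing ℝ X) f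
  have hfv : ∀ q : WeakDual ℝ X, f q = q v := by
    intro q
    rw [← hv]; rfl
  have hu : 0 < u := by
    have := hfu 0 (subset_closure h0)
    simpa using this
  have hle : ∀ q ∈ C, q v ≤ 0 := by
    intro q hq
    by_contra hlt
    push Not at hlt
    have h1 := hfu _ (subset_closure (hsmul (u / q v) (by positivity) q hq))
    rw [map_smul, hfv, smul_eq_mul, div_mul_cancel₀ _ hlt.ne'] at h1
    exact lt_irrefl _ h1
  have := hp v hle
  rw [hfv] at hup
  linarith

/-- Feasible direction lemma. -/
lemma feasible_dir (g : T → X → ℝ) (dg : T → X →L[ℝ] ℝ) (xb : X) (M : ℝ)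
    (hM : ∀ t, ‖dg t‖ ≤ M) (hM0 : 0 ≤ M)
    (hunif : UnifFrechetDiffAt g dg xb) (hle : ∀ t, g t xb ≤ 0)
    (ε : ℝ) (hε : 0 < ε) (w : X) (s : ℝ) (hs : 0 < s)
    (hw : ∀ t, -ε ≤ g t xb → dg t w ≤ -s) :
    ∃ r > (0:ℝ), ∀ t, g t (xb + r • w) ≤ 0 := by
  have hW : 0 < ‖w‖ + 1 := by positivity
  obtain ⟨η, hη, h⟩ := hunif (s / (‖w‖ + 1)) (by positivity)
  have hB : 0 < M * ‖w‖ + s := by positivity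
  set r := min (η / (‖w‖ + 1)) (ε / (M * ‖w‖ + s)) with hr
  have hr0 : 0 < r := lt_min (by positivity) (by positivity)
  have hr1 : r * (‖w‖ + 1) ≤ η := by
    rw [← le_div_iff₀ hW]; exact min_le_left _ _
  have hr2 : r * (M * ‖w‖ + s) ≤ ε := by
    rw [← le_div_iff₀ hB]; exact min_le_right _ _
  refine ⟨r, hr0, fun t => ?_⟩
  have hn : ‖(xb + r • w) - xb‖ = r * ‖w‖ := by
    rw [add_sub_cancel_left, norm_smul, Real.norm_of_nonneg hr0.le]
  have h1 := h t (xb + r • w) (by rw [hn]; nlinarith)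
  rw [hn, add_sub_cancel_left, map_smul, smul_eq_mul] at h1
  have h2 := (abs_le.1 h1).2
  have h3 : s / (‖w‖ + 1) * (r * ‖w‖) ≤ r * s := by
    rw [div_mul_eq_mul_div, div_le_iff₀ hW]
    nlinarith [norm_nonneg w, mul_pos hr0 hs]
  by_cases ht : -ε ≤ g t xb
  · have := hw t ht
    nlinarith [hle t]
  · push Not at ht
    have h4 : dg t w ≤ M * ‖w‖ :=
      (le_abs_self _).trans (((dg t).le_opNorm w).trans
        (mul_le_mul_of_nonneg_right (hM t) (norm_nonneg _)))
    nlinarith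

/-- The normal inequality on linearized critical directions. -/
lemma normal_le (g : T → X → ℝ) (dg : T → X →L[ℝ] ℝ) (A : X →L[ℝ] Y) (xb xt : X) (M : ℝ)
    (hM : ∀ t, ‖dg t‖ ≤ M) (hM0 : 0 ≤ M)
    (hunif : UnifFrechetDiffAt g dg xb) (hAxb : A xb = 0) (hle : ∀ t, g t xb ≤ 0)
    (hAxt : A xt = 0) (ε δ : ℝ) (hε : 0 < ε) (hδ : 0 < δ)
    (hxt : ∀ t, -ε ≤ g t xb → dg t xt ≤ -δ) (p : X →L[ℝ] ℝ)
    (hp : p ∈ convexNormal {x : X | A x = 0 ∧ ∀ t : T, g t x ≤ 0} xb)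
    (v : X) (hAv : A v = 0) (hv : ∀ t, -ε ≤ g t xb → dg t v ≤ 0) : p v ≤ 0 := by
  have key : ∀ s > (0:ℝ), p v + s * p xt ≤ 0 := by
    intro s hs
    obtain ⟨r, hr, hf⟩ := feasible_dir g dg xb M hM hM0 hunif hle ε hε (v + s • xt) (s * δ)
      (by positivity) (by
        intro t ht
        have h1 := hv t ht
        have h2 := hxt t ht
        rw [map_add, map_smul, smul_eq_mul]
        nlinarith)
    have h := hp (xb + r • (v + s • xt)) ⟨by simp [hAxb, hAv, hAxt], hf⟩
    rw [add_sub_cancel_left, map_smul, smul_eq_mul, map_add, map_smul, smul_eq_mul] at h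
    by_contra hc
    push Not at hc
    nlinarith [mul_pos hr hc]
  by_contra hc
  push Not at hc
  have h := key (p v / (2 * (|p xt| + 1))) (by positivity)
  have h2 : p v / (2 * (|p xt| + 1)) * p xt ≥ - (p v / 2) := by
    have h3 : p v / (2 * (|p xt| + 1)) * (|p xt| + 1) = p v / 2 := by field_simp
    have h4 : 0 < p v / (2 * (|p xt| + 1)) := by positivity
    nlinarith [neg_abs_le (p xt)]
  linarith

/-- norm bound on cone -/
lemma cone_norm_le (g : T → X → ℝ) (dg : T → X →L[ℝ] ℝ) (xb xt : X) (M : ℝ)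
    (hM : ∀ t, ‖dg t‖ ≤ M) (hM0 : 0 ≤ M) (ε δ : ℝ) (hδ : 0 < δ)
    (hxt : ∀ t, -ε ≤ g t xb → dg t xt ≤ -δ) {d : X →L[ℝ] ℝ}
    (hd : d ∈ coneHull (dg '' {t : T | -ε ≤ g t xb})) : ‖d‖ ≤ M / δ * (- d xt) := by
  refine coneHull_ind (P := fun d : X →L[ℝ] ℝ => ‖d‖ ≤ M / δ * (- d xt)) ?_ ?_ ?_ ?_ hd
  · simp
  · intro x y hx hy
    calc ‖x + y‖ ≤ ‖x‖ + ‖y‖ := norm_add_le _ _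
      _ ≤ _ := by rw [ContinuousLinearMap.add_apply]; linarith
  · intro r x hr hx
    rw [norm_smul, Real.norm_of_nonneg hr, ContinuousLinearMap.smul_apply, smul_eq_mul]
    nlinarith
  · rintro _ ⟨t, ht, rfl⟩
    have h1 := hxt t ht
    calc ‖dg t‖ ≤ M := hM t
      _ = M / δ * δ := by field_simp
      _ ≤ _ := by
        apply mul_le_mul_of_nonneg_left _ (by positivity)
        linarith

/-- Decomposition for fixed `ε`. -/
lemma decomp_eps (g : T → X → ℝ) (dg : T → X →L[ℝ] ℝ) (A : X →L[ℝ] Y) (xb xt : X) (M : ℝ)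
    (hM : ∀ t, ‖dg t‖ ≤ M) (hM0 : 0 ≤ M)
    (hunif : UnifFrechetDiffAt g dg xb) (hAxb : A xb = 0) (hle : ∀ t, g t xb ≤ 0)
    (hAxt : A xt = 0) (ε δ : ℝ) (hε : 0 < ε) (hδ : 0 < δ)
    (hxt : ∀ t, -ε ≤ g t xb → dg t xt ≤ -δ) (p : X →L[ℝ] ℝ)
    (hp : p ∈ convexNormal {x : X | A x = 0 ∧ ∀ t : T, g t x ≤ 0} xb) :
    ∃ q : WeakDual ℝ X, q ∈ closure (toWD '' coneHull (dg '' {t : T | -ε ≤ g t xb})) ∧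
      q ∈ WeakDual.toStrongDual ⁻¹' Metric.closedBall (0 : StrongDual ℝ X)
        (M / δ * (|p xt| + 1)) ∧ toWD p - q ∈ annKer A := by
  set D : Set (WeakDual ℝ X) := toWD '' coneHull (dg '' {t : T | -ε ≤ g t xb}) with hD
  set R := M / δ * (|p xt| + 1) with hR
  set B : Set (WeakDual ℝ X) :=
    WeakDual.toStrongDual ⁻¹' Metric.closedBall (0 : StrongDual ℝ X) R with hB
  have hD0 : (0 : WeakDual ℝ X) ∈ D := ⟨0, coneHull_zero _, rfl⟩
  have hN0 : (0 : WeakDual ℝ X) ∈ annKer A := fun v _ => rfl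
  have h1 : toWD p ∈ closure (D + annKer A) := by
    apply mem_closure_cone
    · exact ⟨0, hD0, 0, hN0, by simp⟩
    · rintro _ ⟨_, ⟨a, ha, rfl⟩, b, hb, rfl⟩ _ ⟨_, ⟨c, hc, rfl⟩, d, hd, rfl⟩
      refine ⟨toWD a + toWD c, ⟨a + c, coneHull_add ha hc, rfl⟩, b + d, ?_, ?_⟩
      · intro v hv
        have e1 := hb v hv
        have e2 := hd v hv
        change b v + d v = 0
        rw [e1, e2, add_zero]
      · simp only
        abel
    · rintro r hr _ ⟨_, ⟨a, ha, rfl⟩, b, hb, rfl⟩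
      refine ⟨r • toWD a, ⟨r • a, coneHull_smul hr ha, rfl⟩, r • b, ?_, ?_⟩
      · intro v hv
        have e1 := hb v hv
        change r • (b v) = 0
        rw [e1, smul_zero]
      · simp only [smul_add]
    · intro v hv
      have hAv : A v = 0 := by
        by_contra hne
        obtain ⟨f, -, hf⟩ := exists_dual_vector ℝ (A v) (by simpa using hne)
        have := hv (toWD (f.comp A)) ⟨0, hD0, toWD (f.comp A), fun u hu => by
          change f (A u) = 0
          rw [hu, map_zero], by simp⟩
        have h2 : f (A v) ≤ 0 := this
        rw [hf] at h2
        have h3 : ‖A v‖ ≤ 0 := by simpa using h2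
        exact hne (norm_le_zero_iff.1 h3)
      refine normal_le g dg A xb xt M hM hM0 hunif hAxb hle hAxt ε δ hε hδ hxt p hp v hAv ?_
      intro t ht
      exact hv (toWD (dg t)) ⟨toWD (dg t), ⟨dg t, coneHull_gen ⟨t, ht, rfl⟩, rfl⟩, 0, hN0, by simp⟩
  have hU : IsOpen {q : WeakDual ℝ X | p xt - 1 < q xt} :=
    isOpen_lt continuous_const (WeakDual.eval_continuous xt)
  have h2 : toWD p ∈ closure ({q : WeakDual ℝ X | p xt - 1 < q xt} ∩ (D + annKer A)) := by
    refine hU.inter_closure ⟨?_, h1⟩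
    change p xt - 1 < p xt
    linarith
  have hcl : IsClosed ((closure D ∩ B) + annKer A) := by
    have hBc : IsCompact B := WeakDual.isCompact_closedBall 0 R
    exact (annKer_closed A).add_left_of_isCompact (hBc.inter_left isClosed_closure)
  have h3 : toWD p ∈ (closure D ∩ B) + annKer A := by
    refine closure_minimal ?_ hcl h2
    rintro _ ⟨hlt, _, ⟨a, ha, rfl⟩, b, hb, rfl⟩
    refine ⟨toWD a, ⟨subset_closure ⟨a, ha, rfl⟩, ?_⟩, b, hb, rfl⟩
    have e1 : p xt - 1 < a xt + b xt := hlt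
    rw [hb xt hAxt, add_zero] at e1
    have e2 := cone_norm_le g dg xb xt M hM hM0 ε δ hδ hxt ha
    change a ∈ Metric.closedBall (0 : StrongDual ℝ X) R
    rw [mem_closedBall_zero_iff]
    refine e2.trans (mul_le_mul_of_nonneg_left ?_ (by positivity))
    linarith [neg_abs_le (p xt)]
  obtain ⟨q, ⟨hq1, hq2⟩, b, hb, hqb⟩ := h3
  refine ⟨q, hq1, hq2, ?_⟩
  have : toWD p - q = b := by rw [← hqb]; simp
  rw [this]; exact hb

end Helpers

/-- convex infinite systems: assume all `g t` are convex and uniformly Fréchet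
differentiable at `xb ∈ Ω`, `A` is a surjective continuous linear operator, and the PMFCQ
(equivalently the SSC) holds at `xb`. Then the normal cone of convex analysis to `Ω` at `xb`
is `⋂_{ε>0} cl* cone{dg t : t ∈ T_ε(xb)} + A*(Y*)`; if in addition the NFMCQ holds at `xb`,
then `N(xb; Ω) = cone{dg t : t ∈ T(xb)} + A*(Y*)`. -/
theorem statement14 {X Y T : Type*} [NormedAddCommGroup X] [NormedSpace ℝ X] [CompleteSpace X]
    [NormedAddCommGroup Y] [NormedSpace ℝ Y] [CompleteSpace Y]
    (g : T → X → ℝ) (dg : T → X →L[ℝ] ℝ) (A : X →L[ℝ] Y) (xb : X)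
    (hconv : ∀ t : T, ConvexOn ℝ univ (g t))
    (hgd : ∀ t : T, HasFDerivAt (g t) (dg t) xb)
    (hbd : ∃ M : ℝ, ∀ t : T, ‖dg t‖ ≤ M)
    (hunif : UnifFrechetDiffAt g dg xb)
    (hxb : xb ∈ {x : X | A x = 0 ∧ ∀ t : T, g t x ≤ 0})
    (hsurj : Function.Surjective A)
    (hpmfcq : ∃ xt : X, A xt = 0 ∧ PMFCQat g dg xb xt) :
    convexNormal {x : X | A x = 0 ∧ ∀ t : T, g t x ≤ 0} xb =
        (⋂ ε > (0:ℝ), wkClosure (coneHull (dg '' {t : T | -ε ≤ g t xb}))) + adjRange A ∧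
      (IsWeakStarClosedProd (coneHull (Set.range fun t : T => (dg t, dg t xb - g t xb))) →
        convexNormal {x : X | A x = 0 ∧ ∀ t : T, g t x ≤ 0} xb =
          coneHull (dg '' {t : T | g t xb = 0}) + adjRange A) := by
  obtain ⟨M', hM'⟩ := hbd
  obtain ⟨xt, hAxt, ε₀, hε₀, δ, hδ, hxt⟩ := hpmfcq
  obtain ⟨hAxb, hle⟩ := hxb
  obtain ⟨M, hM, hM0⟩ : ∃ M : ℝ, (∀ t, ‖dg t‖ ≤ M) ∧ 0 ≤ M :=
    ⟨max M' 0, fun t => (hM' t).trans (le_max_left _ _), le_max_right _ _⟩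
  have hgrad : ∀ t x, dg t (x - xb) ≤ g t x - g t xb := by
    intro t x
    by_contra hc
    push Not at hc
    set e := dg t (x - xb) - (g t x - g t xb) with he
    have he0 : 0 < e := by linarith
    obtain ⟨η, hη, h⟩ := hunif (e / (2 * (‖x - xb‖ + 1))) (by positivity)
    have hW : 0 < ‖x - xb‖ + 1 := by positivity
    set r := min 1 (η / (‖x - xb‖ + 1)) with hr
    have hr0 : 0 < r := lt_min one_pos (by positivity)
    have hr1 : r ≤ 1 := min_le_left _ _
    have hr2 : r * (‖x - xb‖ + 1) ≤ η := by
      rw [← le_div_iff₀ hW]; exact min_le_right _ _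
    have hn : ‖(xb + r • (x - xb)) - xb‖ = r * ‖x - xb‖ := by
      rw [add_sub_cancel_left, norm_smul, Real.norm_of_nonneg hr0.le]
    have h1 := h t (xb + r • (x - xb)) (by rw [hn]; nlinarith)
    rw [hn, add_sub_cancel_left, map_smul, smul_eq_mul] at h1
    have h2 := (abs_le.1 h1).1
    have h3 := (hconv t).2 (mem_univ xb) (mem_univ x) (sub_nonneg.2 hr1) hr0.le (by ring)
    have h4 : (1 - r) • xb + r • x = xb + r • (x - xb) := by module
    rw [h4, smul_eq_mul, smul_eq_mul] at h3
    have h5 : e / (2 * (‖x - xb‖ + 1)) * (r * ‖x - xb‖) ≤ r * e / 2 := by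
      have : e / (2 * (‖x - xb‖ + 1)) * (r * (‖x - xb‖ + 1)) = r * e / 2 := by field_simp
      rw [← this]
      gcongr
      linarith
    nlinarith [mul_pos hr0 he0]
  have hsup : (⋂ ε > (0:ℝ), wkClosure (coneHull (dg '' {t : T | -ε ≤ g t xb}))) + adjRange A ⊆
      convexNormal {x : X | A x = 0 ∧ ∀ t : T, g t x ≤ 0} xb := by
    rintro _ ⟨q, hq, _, ⟨y, rfl⟩, rfl⟩ x ⟨hAx, hgx⟩
    have e1 : (q + y.comp A) (x - xb) = q (x - xb) := by
      simp [hAx, hAxb]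
    change (q + y.comp A) (x - xb) ≤ 0
    rw [e1]
    have key : ∀ ε > (0:ℝ), ε ≤ ε₀ → q (x - xb) ≤ ε / δ * (- q xt) := by
      intro ε hε hεε
      have hqe : toWD q ∈ closure (toWD '' coneHull (dg '' {t : T | -ε ≤ g t xb})) :=
        Set.mem_iInter₂.1 hq ε hε
      have hcl : IsClosed {d : WeakDual ℝ X | d (x - xb) ≤ ε / δ * (- d xt)} :=
        isClosed_le (WeakDual.eval_continuous _)
          (continuous_const.mul (WeakDual.eval_continuous _).neg)
      refine closure_minimal ?_ hcl hqe
      rintro _ ⟨d, hd, rfl⟩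
      refine coneHull_ind (P := fun d : X →L[ℝ] ℝ => d (x - xb) ≤ ε / δ * (- d xt))
        ?_ ?_ ?_ ?_ hd
      · simp
      · intro a b ha hb
        rw [ContinuousLinearMap.add_apply, ContinuousLinearMap.add_apply]
        linarith
      · intro r a hr ha
        rw [ContinuousLinearMap.smul_apply, ContinuousLinearMap.smul_apply, smul_eq_mul,
          smul_eq_mul]
        nlinarith
      · rintro _ ⟨t, ht, rfl⟩
        have ht' : -ε ≤ g t xb := ht
        have h1 := hxt t (by linarith)
        have h2 := hgrad t x
        have h3 := hgx t
        calc dg t (x - xb) ≤ ε := by linarith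
          _ = ε / δ * δ := by field_simp
          _ ≤ _ := by
            apply mul_le_mul_of_nonneg_left _ (by positivity)
            linarith
    by_contra hc
    push Not at hc
    have hb : 0 < |q xt| + 1 := by positivity
    set ε := min ε₀ (δ * q (x - xb) / (2 * (|q xt| + 1))) with hε
    have hε0 : 0 < ε := lt_min hε₀ (by positivity)
    have h1 := key ε hε0 (min_le_left _ _)
    have h2 : ε / δ * (|q xt| + 1) ≤ q (x - xb) / 2 := by
      have : ε ≤ δ * q (x - xb) / (2 * (|q xt| + 1)) := min_le_right _ _
      calc ε / δ * (|q xt| + 1) ≤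
          (δ * q (x - xb) / (2 * (|q xt| + 1))) / δ * (|q xt| + 1) := by gcongr
        _ = _ := by field_simp
    have h3 : ε / δ * (- q xt) ≤ ε / δ * (|q xt| + 1) := by
      apply mul_le_mul_of_nonneg_left _ (by positivity)
      linarith [neg_abs_le (q xt)]
    linarith
  have hdec : ∀ p ∈ convexNormal {x : X | A x = 0 ∧ ∀ t : T, g t x ≤ 0} xb,
      ∃ q ∈ (⋂ ε > (0:ℝ), wkClosure (coneHull (dg '' {t : T | -ε ≤ g t xb}))),
        ∃ a ∈ adjRange A, q + a = p := by
    intro p hp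
    let e : ℕ → ℝ := fun n => ε₀ / (n + 1)
    have he0 : ∀ n, 0 < e n := fun n => by positivity
    have heanti : ∀ n, e (n + 1) ≤ e n := fun n => by
      simp only [e]; gcongr; simp
    have hele : ∀ n, e n ≤ ε₀ := fun n => by
      apply div_le_self hε₀.le
      have : (0:ℝ) ≤ n := Nat.cast_nonneg n
      linarith
    let K : ℕ → Set (WeakDual ℝ X) := fun n =>
      closure (toWD '' coneHull (dg '' {t : T | -(e n) ≤ g t xb})) ∩
        (WeakDual.toStrongDual ⁻¹' Metric.closedBall (0 : StrongDual ℝ X)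
          (M / δ * (|p xt| + 1)) ∩ {q | toWD p - q ∈ annKer A})
    have hlast : IsClosed {q : WeakDual ℝ X | toWD p - q ∈ annKer A} :=
      (annKer_closed A).preimage (continuous_const.sub continuous_id)
    have hBc : IsCompact (WeakDual.toStrongDual ⁻¹' Metric.closedBall (0 : StrongDual ℝ X)
          (M / δ * (|p xt| + 1))) := WeakDual.isCompact_closedBall 0 _
    have hKc : ∀ n, IsCompact (K n) := fun n =>
      (hBc.inter_right hlast).inter_left isClosed_closure
    have hne : (⋂ n, K n).Nonempty := by
      apply IsCompact.nonempty_iInter_of_sequence_nonempty_isCompact_isClosed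
      · intro n
        refine inter_subset_inter_left _ (closure_mono (image_mono (coneHull_mono
          (image_mono ?_))))
        intro t ht
        have ht' : -(e (n + 1)) ≤ g t xb := ht
        have := heanti n
        change -(e n) ≤ g t xb
        linarith
      · intro n
        obtain ⟨q, h1, h2, h3⟩ := decomp_eps g dg A xb xt M hM hM0 hunif hAxb hle hAxt (e n) δ
          (he0 n) hδ (fun t ht => hxt t (by linarith [hele n])) p hp
        exact ⟨q, h1, h2, h3⟩
      · exact hKc 0
      · exact fun n => (hKc n).isClosed
    obtain ⟨q, hq⟩ := hne
    rw [mem_iInter] at hq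
    let q' : X →L[ℝ] ℝ := WeakDual.toStrongDual q
    refine ⟨q', ?_, p - q', ?_, by abel⟩
    · refine mem_iInter₂.2 fun ε hε => ?_
      obtain ⟨n, hn⟩ := exists_nat_gt (ε₀ / ε)
      have hen : e n ≤ ε := by
        have hn1 : (0:ℝ) < n + 1 := by positivity
        simp only [e]
        rw [div_le_iff₀ hn1]
        rw [div_lt_iff₀ hε] at hn
        nlinarith
      change q ∈ closure (toWD '' coneHull (dg '' {t : T | -ε ≤ g t xb}))
      refine closure_mono (image_mono (coneHull_mono (image_mono ?_))) (hq n).1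
      intro t ht
      have ht' : -(e n) ≤ g t xb := ht
      change -ε ≤ g t xb
      linarith
    · exact mem_adjRange_of_annKer A hsurj _ fun v hv => (hq 0).2.2 v hv
  refine ⟨?_, ?_⟩
  · apply Subset.antisymm _ hsup
    intro p hp
    obtain ⟨q, hq, a, ha, h⟩ := hdec p hp
    exact ⟨q, hq, a, ha, h⟩
  · intro hcl
    apply Subset.antisymm
    · intro p hp
      obtain ⟨q, hq, a, ha, h⟩ := hdec p hp
      refine ⟨q, ?_, a, ha, h⟩
      have hmem : ((toWD q, q xb) : WeakDual ℝ X × ℝ) ∈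
          (fun p : (X →L[ℝ] ℝ) × ℝ => (toWD p.1, p.2)) ''
            (coneHull (Set.range fun t : T => (dg t, dg t xb - g t xb))) := by
        rw [← IsClosed.closure_eq hcl]
        rw [mem_closure_iff_nhds]
        intro N hN
        rw [nhds_prod_eq, Filter.mem_prod_iff] at hN
        obtain ⟨U, hU, V, hV, hUV⟩ := hN
        obtain ⟨ρ, hρ, hρV⟩ := Metric.mem_nhds_iff.1 hV
        have hb : 0 < |q xt| + 1 := by positivity
        set ε := min ε₀ (δ * ρ / (4 * (|q xt| + 1))) with hεdef
        have hε : 0 < ε := lt_min hε₀ (by positivity)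
        have hqe : toWD q ∈ closure (toWD '' coneHull (dg '' {t : T | -ε ≤ g t xb})) :=
          Set.mem_iInter₂.1 hq ε hε
        have hU1 : {d : WeakDual ℝ X | q xt - 1 < d xt} ∈ 𝓝 (toWD q) :=
          (isOpen_lt continuous_const (WeakDual.eval_continuous xt)).mem_nhds
            (show q xt - 1 < q xt by linarith)
        have hU2 : {d : WeakDual ℝ X | |d xb - q xb| < ρ / 2} ∈ 𝓝 (toWD q) :=
          (isOpen_lt ((WeakDual.eval_continuous xb).sub continuous_const).abs
            continuous_const).mem_nhds
            (show |q xb - q xb| < ρ / 2 by simpa using hρ)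
        obtain ⟨_, ⟨⟨hdU, hd1⟩, hd2⟩, d, hd, rfl⟩ := mem_closure_iff_nhds.1 hqe _
          (Filter.inter_mem (Filter.inter_mem hU hU1) hU2)
        have hd1' : q xt - 1 < d xt := hd1
        have hd2' : |d xb - q xb| < ρ / 2 := hd2
        obtain ⟨r, hr, hr1, hr2⟩ : ∃ r : ℝ,
            (d, r) ∈ coneHull (Set.range fun t : T => (dg t, dg t xb - g t xb)) ∧
            d xb ≤ r ∧ r ≤ d xb + ε / δ * (- d xt) := by
          refine coneHull_ind (P := fun d : X →L[ℝ] ℝ => ∃ r : ℝ,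
            (d, r) ∈ coneHull (Set.range fun t : T => (dg t, dg t xb - g t xb)) ∧
            d xb ≤ r ∧ r ≤ d xb + ε / δ * (- d xt)) ?_ ?_ ?_ ?_ hd
          · exact ⟨0, coneHull_zero _, by simp, by simp⟩
          · rintro a b ⟨r, h1, h2, h3⟩ ⟨r', h1', h2', h3'⟩
            refine ⟨r + r', coneHull_add h1 h1', ?_, ?_⟩
            · rw [ContinuousLinearMap.add_apply]; linarith
            · rw [ContinuousLinearMap.add_apply, ContinuousLinearMap.add_apply]; linarith
          · rintro c a hc ⟨r, h1, h2, h3⟩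
            refine ⟨c * r, coneHull_smul hc h1, ?_, ?_⟩
            · rw [ContinuousLinearMap.smul_apply, smul_eq_mul]
              exact mul_le_mul_of_nonneg_left h2 hc
            · rw [ContinuousLinearMap.smul_apply, ContinuousLinearMap.smul_apply, smul_eq_mul,
                smul_eq_mul]
              have := mul_le_mul_of_nonneg_left h3 hc
              linarith
          · rintro _ ⟨t, ht, rfl⟩
            have ht' : -ε ≤ g t xb := ht
            refine ⟨dg t xb - g t xb, coneHull_gen ⟨t, rfl⟩, by linarith [hle t], ?_⟩
            have h1 := hxt t (by linarith [min_le_left ε₀ (δ * ρ / (4 * (|q xt| + 1)))])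
            have h2 : ε = ε / δ * δ := by field_simp
            have h3 : ε / δ * δ ≤ ε / δ * (- dg t xt) := by
              apply mul_le_mul_of_nonneg_left _ (by positivity)
              linarith
            linarith
        refine ⟨(toWD d, r), hUV ⟨hdU, hρV ?_⟩, (d, r), hr, rfl⟩
        rw [Metric.mem_ball, Real.dist_eq]
        have h2 : ε / δ * (|q xt| + 1) ≤ ρ / 4 := by
          have : ε ≤ δ * ρ / (4 * (|q xt| + 1)) := min_le_right _ _
          calc ε / δ * (|q xt| + 1) ≤
              (δ * ρ / (4 * (|q xt| + 1))) / δ * (|q xt| + 1) := by gcongr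
            _ = _ := by field_simp
        have h3 : ε / δ * (- d xt) ≤ ε / δ * (|q xt| + 1) := by
          apply mul_le_mul_of_nonneg_left _ (by positivity)
          linarith [neg_abs_le (q xt)]
        obtain ⟨h4, h5⟩ := abs_lt.1 hd2'
        rw [abs_lt]
        constructor <;> linarith
      obtain ⟨⟨q', r⟩, ⟨n, c, v, hc, hv, hsum⟩, hqr⟩ := hmem
      have hq' : q' = q := (Prod.ext_iff.1 hqr).1
      have hr : r = q xb := (Prod.ext_iff.1 hqr).2
      subst hq' hr
      choose t ht using hv
      have hs1 : q' = ∑ i, c i • dg (t i) := by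
        have := congrArg Prod.fst hsum
        simpa [Prod.fst_sum, ← ht] using this
      have hs2 : q' xb = ∑ i, c i * (dg (t i) xb - g (t i) xb) := by
        have := congrArg Prod.snd hsum
        simpa [Prod.snd_sum, ← ht] using this
      have hs3 : q' xb = ∑ i, c i * dg (t i) xb := by
        rw [hs1]; simp [ContinuousLinearMap.sum_apply]
      have hs4 : ∑ i, c i * (- g (t i) xb) = 0 := by
        have : ∑ i, c i * (- g (t i) xb) =
            ∑ i, c i * (dg (t i) xb - g (t i) xb) - ∑ i, c i * dg (t i) xb := by
          rw [← Finset.sum_sub_distrib]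
          exact Finset.sum_congr rfl fun i _ => by ring
        rw [this, ← hs2, ← hs3, sub_self]
      have hs5 := (Finset.sum_eq_zero_iff_of_nonneg (fun i _ =>
        mul_nonneg (hc i) (neg_nonneg.2 (hle (t i))))).1 hs4
      rw [hs1]
      refine Finset.sum_induction _ (· ∈ coneHull (dg '' {t : T | g t xb = 0}))
        (fun _ _ => coneHull_add) (coneHull_zero _) fun i hi => ?_
      rcases mul_eq_zero.1 (hs5 i hi) with h0 | h0
      · rw [h0, zero_smul]; exact coneHull_zero _
      · exact coneHull_smul (hc i) (coneHull_gen ⟨t i, neg_eq_zero.1 h0, rfl⟩)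
    · refine Subset.trans (add_subset_add_right ?_) hsup
      intro d hd
      refine mem_iInter₂.2 fun ε hε => ?_
      have hsub : toWD d ∈ toWD (X := X) '' coneHull (dg '' {t : T | -ε ≤ g t xb}) := by
        refine ⟨d, coneHull_mono (image_mono ?_) hd, rfl⟩
        intro t ht
        have ht0 : g t xb = 0 := ht
        change -ε ≤ g t xb
        linarith
      change toWD d ∈ closure (toWD '' coneHull (dg '' {t : T | -ε ≤ g t xb}))
      exact subset_closure hsub
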